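/- (Quadratic growth of the inner-loop optimality gap in the gain.) Let K ∈ 𝒦. Then for every maximizer gain L, φ · (min_{0≤t≤N−1} λ_min(R^w_t − D_tᵀP^K_{t+1}D_t)) · Σ_{t=0}^{N−1} ‖L(K)_t − L_t‖_F² ≤ G(K,L(K)) − G(K,L). In particular, ‖L(K) − L‖_F ≤ ( (G(K,L(K)) − G(K,L)) / (φ · min_t λ_min(R^w_t − D_tᵀP^K_{t+1}D_t)) )^{1/2}. -/

import Mathlib

open Matrix

noncomputable section

/-- Rayleigh-quotient value set of a square real matrix. -/
def rayleighSet {a : ℕ} (M : Matrix (Fin a) (Fin a) ℝ) : Set ℝ :=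
  { r : ℝ | ∃ x : Fin a → ℝ, x ⬝ᵥ x = 1 ∧ r = x ⬝ᵥ M.mulVec x }

/-- Smallest eigenvalue (of a symmetric matrix), via the Rayleigh characterization. -/
def eigMin {a : ℕ} (M : Matrix (Fin a) (Fin a) ℝ) : ℝ := sInf (rayleighSet M)

/-- Largest eigenvalue (of a symmetric matrix), via the Rayleigh characterization. -/
def eigMax {a : ℕ} (M : Matrix (Fin a) (Fin a) ℝ) : ℝ := sSup (rayleighSet M)

/-- Operator (spectral) norm of a real matrix. -/
def opNorm {a b : ℕ} (M : Matrix (Fin a) (Fin b) ℝ) : ℝ := Real.sqrt (eigMax (Mᵀ * M))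

/-- Squared Frobenius norm. -/
def frobNormSq {a b : ℕ} (M : Matrix (Fin a) (Fin b) ℝ) : ℝ := ∑ i, ∑ j, (M i j) ^ 2

/-- Frobenius norm. -/
def frobNorm {a b : ℕ} (M : Matrix (Fin a) (Fin b) ℝ) : ℝ := Real.sqrt (frobNormSq M)

/-- Extend a finite tuple to a function on `ℕ` by zero. -/
def padZero {α : Type*} [Zero α] {N : ℕ} (f : Fin N → α) : ℕ → α :=
  fun t => if h : t < N then f ⟨t, h⟩ else 0

/-- Data of a finite-horizon zero-sum LQ dynamic game with horizon `N`. -/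
structure LQGame (m d n N : ℕ) where
  A : ℕ → Matrix (Fin m) (Fin m) ℝ
  B : ℕ → Matrix (Fin m) (Fin d) ℝ
  D : ℕ → Matrix (Fin m) (Fin n) ℝ
  Q : ℕ → Matrix (Fin m) (Fin m) ℝ
  QN : Matrix (Fin m) (Fin m) ℝ
  Ru : ℕ → Matrix (Fin d) (Fin d) ℝ
  Rw : ℕ → Matrix (Fin n) (Fin n) ℝ
  Sig : ℕ → Matrix (Fin m) (Fin m) ℝ
  hQ : ∀ t < N, (Q t).PosSemidef
  hQN : QN.PosSemidef
  hRu : ∀ t < N, (Ru t).PosDef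
  hRw : ∀ t < N, (Rw t).PosDef
  hSig : ∀ t ≤ N, (Sig t).PosDef

namespace LQGame

variable {m d n N : ℕ}

/-- Value matrices `P^{K,L}` indexed by the number `j` of steps before the terminal
time, i.e. `PKLaux g K L j = P^{K,L}_{N-j}`. -/
def PKLaux (g : LQGame m d n N) (K : ℕ → Matrix (Fin d) (Fin m) ℝ)
    (L : ℕ → Matrix (Fin n) (Fin m) ℝ) : ℕ → Matrix (Fin m) (Fin m) ℝ
  | 0 => g.QN
  | j + 1 =>
      (g.A (N - (j+1)) - g.B (N - (j+1)) * K (N - (j+1)) - g.D (N - (j+1)) * L (N - (j+1)))ᵀ *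
          PKLaux g K L j *
          (g.A (N - (j+1)) - g.B (N - (j+1)) * K (N - (j+1)) - g.D (N - (j+1)) * L (N - (j+1)))
        + g.Q (N - (j+1)) + (K (N - (j+1)))ᵀ * g.Ru (N - (j+1)) * K (N - (j+1))
        - (L (N - (j+1)))ᵀ * g.Rw (N - (j+1)) * L (N - (j+1))

/-- Value matrix `P^{K,L}_t`. -/
def PKL (g : LQGame m d n N) (K : ℕ → Matrix (Fin d) (Fin m) ℝ)
    (L : ℕ → Matrix (Fin n) (Fin m) ℝ) (t : ℕ) : Matrix (Fin m) (Fin m) ℝ :=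
  PKLaux g K L (N - t)

/-- Inner-loop Riccati matrices indexed by the number `j` of steps before the terminal
time, i.e. `PKaux g K j = P^K_{N-j}`. -/
def PKaux (g : LQGame m d n N) (K : ℕ → Matrix (Fin d) (Fin m) ℝ) :
    ℕ → Matrix (Fin m) (Fin m) ℝ
  | 0 => g.QN
  | j + 1 =>
      g.Q (N - (j+1)) + (K (N - (j+1)))ᵀ * g.Ru (N - (j+1)) * K (N - (j+1))
        + (g.A (N - (j+1)) - g.B (N - (j+1)) * K (N - (j+1)))ᵀ *
          (PKaux g K j + PKaux g K j * g.D (N - (j+1)) *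
            (g.Rw (N - (j+1)) - (g.D (N - (j+1)))ᵀ * PKaux g K j * g.D (N - (j+1)))⁻¹ *
            (g.D (N - (j+1)))ᵀ * PKaux g K j) *
          (g.A (N - (j+1)) - g.B (N - (j+1)) * K (N - (j+1)))

/-- Inner-loop Riccati matrix `P^K_t`. -/
def PK (g : LQGame m d n N) (K : ℕ → Matrix (Fin d) (Fin m) ℝ) (t : ℕ) :
    Matrix (Fin m) (Fin m) ℝ :=
  PKaux g K (N - t)

/-- `P̃^K_{t+1}`. -/
def Ptilde (g : LQGame m d n N) (K : ℕ → Matrix (Fin d) (Fin m) ℝ) (t : ℕ) :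
    Matrix (Fin m) (Fin m) ℝ :=
  g.PK K (t+1) + g.PK K (t+1) * g.D t *
    (g.Rw t - (g.D t)ᵀ * g.PK K (t+1) * g.D t)⁻¹ * (g.D t)ᵀ * g.PK K (t+1)

/-- `K ∈ 𝒦`. -/
def Admissible (g : LQGame m d n N) (K : ℕ → Matrix (Fin d) (Fin m) ℝ) : Prop :=
  ∀ t < N, (g.Rw t - (g.D t)ᵀ * g.PK K (t+1) * g.D t).PosDef

/-- The inner maximizer `L(K)`. -/
def Lopt (g : LQGame m d n N) (K : ℕ → Matrix (Fin d) (Fin m) ℝ) (t : ℕ) :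
    Matrix (Fin n) (Fin m) ℝ :=
  (-(g.Rw t) + (g.D t)ᵀ * g.PK K (t+1) * g.D t)⁻¹ *
    ((g.D t)ᵀ * g.PK K (t+1) * (g.A t - g.B t * K t))

/-- State covariances `X^{K,L}_t`. -/
def Xcov (g : LQGame m d n N) (K : ℕ → Matrix (Fin d) (Fin m) ℝ)
    (L : ℕ → Matrix (Fin n) (Fin m) ℝ) : ℕ → Matrix (Fin m) (Fin m) ℝ
  | 0 => g.Sig 0
  | t + 1 =>
      (g.A t - g.B t * K t - g.D t * L t) * Xcov g K L t *
        (g.A t - g.B t * K t - g.D t * L t)ᵀ + g.Sig (t+1)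

/-- The game value `G(K,L)`. -/
def value (g : LQGame m d n N) (K : ℕ → Matrix (Fin d) (Fin m) ℝ)
    (L : ℕ → Matrix (Fin n) (Fin m) ℝ) : ℝ :=
  ∑ t ∈ Finset.range (N+1), ((g.PKL K L t) * g.Sig t).trace

/-- `E^{K,L}_t`. -/
def Emat (g : LQGame m d n N) (K : ℕ → Matrix (Fin d) (Fin m) ℝ)
    (L : ℕ → Matrix (Fin n) (Fin m) ℝ) (t : ℕ) : Matrix (Fin n) (Fin m) ℝ :=
  (-(g.Rw t) + (g.D t)ᵀ * g.PKL K L (t+1) * g.D t) * L t -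
    (g.D t)ᵀ * g.PKL K L (t+1) * (g.A t - g.B t * K t)

/-- `H^{K,L}_t`. -/
def Hmat (g : LQGame m d n N) (K : ℕ → Matrix (Fin d) (Fin m) ℝ)
    (L : ℕ → Matrix (Fin n) (Fin m) ℝ) (t : ℕ) : Matrix (Fin n) (Fin n) ℝ :=
  g.Rw t - (g.D t)ᵀ * g.PKL K L (t+1) * g.D t

/-- `F^K_t`. -/
def Fmat (g : LQGame m d n N) (K : ℕ → Matrix (Fin d) (Fin m) ℝ) (t : ℕ) :
    Matrix (Fin d) (Fin m) ℝ :=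
  (g.Ru t + (g.B t)ᵀ * g.Ptilde K t * g.B t) * K t - (g.B t)ᵀ * g.Ptilde K t * g.A t

/-- `G^K_t`. -/
def Gmat (g : LQGame m d n N) (K : ℕ → Matrix (Fin d) (Fin m) ℝ) (t : ℕ) :
    Matrix (Fin d) (Fin d) ℝ :=
  g.Ru t + (g.B t)ᵀ * g.Ptilde K t * g.B t

/-- Game Riccati recursion `P*` indexed by steps before terminal time. -/
def Pstaraux (g : LQGame m d n N) : ℕ → Matrix (Fin m) (Fin m) ℝ
  | 0 => g.QN
  | j + 1 =>
      g.Q (N - (j+1)) + (g.A (N - (j+1)))ᵀ * Pstaraux g j *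
        (1 + (g.B (N - (j+1)) * (g.Ru (N - (j+1)))⁻¹ * (g.B (N - (j+1)))ᵀ
            - g.D (N - (j+1)) * (g.Rw (N - (j+1)))⁻¹ * (g.D (N - (j+1)))ᵀ) * Pstaraux g j)⁻¹ *
        g.A (N - (j+1))

/-- `P*_t`. -/
def Pstar (g : LQGame m d n N) (t : ℕ) : Matrix (Fin m) (Fin m) ℝ :=
  Pstaraux g (N - t)

/-- `Λ_t` of the game Riccati recursion. -/
def LambdaStar (g : LQGame m d n N) (t : ℕ) : Matrix (Fin m) (Fin m) ℝ :=
  1 + (g.B t * (g.Ru t)⁻¹ * (g.B t)ᵀ - g.D t * (g.Rw t)⁻¹ * (g.D t)ᵀ) * g.Pstar (t+1)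

/-- Assumption 2.4. -/
def Assumption24 (g : LQGame m d n N) : Prop :=
  (∀ t < N, IsUnit (g.LambdaStar t)) ∧ (∀ t ≤ N, (g.Pstar t).PosSemidef) ∧
    (∀ t < N, (g.Rw t - (g.D t)ᵀ * g.Pstar (t+1) * g.D t).PosDef)

/-- `φ := min_{0 ≤ t ≤ N} λ_min(Σ⁰_t)`. -/
def phi (g : LQGame m d n N) : ℝ :=
  (Finset.range (N+1)).inf' (Finset.nonempty_range_iff.mpr (Nat.succ_ne_zero N))
    (fun t => eigMin (g.Sig t))

end LQGame
section Rayleigh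

variable {a b : ℕ} {M : Matrix (Fin a) (Fin a) ℝ}

theorem eigMin_nonneg (hM : M.PosSemidef) : 0 ≤ eigMin M := by
  refine Real.sInf_nonneg ?_
  rintro r ⟨x, -, rfl⟩
  simpa using hM.dotProduct_mulVec_nonneg x

theorem eigMin_mul_dotProduct_le (hM : M.PosSemidef) (x : Fin a → ℝ) :
    eigMin M * (x ⬝ᵥ x) ≤ x ⬝ᵥ M.mulVec x := by
  have hx : 0 ≤ x ⬝ᵥ x := by simpa using dotProduct_star_self_nonneg x
  rcases hx.eq_or_lt with h0 | hpos
  · rw [← h0, mul_zero]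
    simpa using hM.dotProduct_mulVec_nonneg x
  · set s := Real.sqrt (x ⬝ᵥ x) with hs
    have hs2 : s * s = x ⬝ᵥ x := Real.mul_self_sqrt hx
    have hs0 : s ≠ 0 := (Real.sqrt_pos.mpr hpos).ne'
    have hbdd : BddBelow (rayleighSet M) := by
      refine ⟨0, ?_⟩
      rintro r ⟨y, -, rfl⟩
      simpa using hM.dotProduct_mulVec_nonneg y
    have hle : eigMin M ≤ (s⁻¹ • x) ⬝ᵥ M.mulVec (s⁻¹ • x) := by
      refine csInf_le hbdd ⟨s⁻¹ • x, ?_, rfl⟩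
      rw [smul_dotProduct, dotProduct_smul, ← hs2, smul_eq_mul, smul_eq_mul]
      field_simp
    rw [mulVec_smul, smul_dotProduct, dotProduct_smul, smul_eq_mul, smul_eq_mul] at hle
    calc eigMin M * (x ⬝ᵥ x)
        ≤ s⁻¹ * (s⁻¹ * (x ⬝ᵥ M.mulVec x)) * (x ⬝ᵥ x) := mul_le_mul_of_nonneg_right hle hx
      _ = x ⬝ᵥ M.mulVec x := by rw [← hs2]; field_simp

theorem eigMin_pos (ha : 0 < a) (hM : M.PosDef) : 0 < eigMin M := by
  let S : Set (Fin a → ℝ) := {x | x ⬝ᵥ x = 1}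
  have hS : IsCompact S := by
    refine Metric.isCompact_of_isClosed_isBounded
      (isClosed_eq (by unfold dotProduct; fun_prop) continuous_const) ?_
    refine (Metric.isBounded_closedBall (x := (0 : Fin a → ℝ)) (r := 1)).subset fun x hx => ?_
    rw [mem_closedBall_zero_iff, pi_norm_le_iff_of_nonneg zero_le_one]
    intro i
    have h1 : x i * x i ≤ ∑ j, x j * x j :=
      Finset.single_le_sum (f := fun j => x j * x j) (fun j _ => mul_self_nonneg _)
        (Finset.mem_univ i)
    have h2 : ∑ j, x j * x j = 1 := hx
    rw [Real.norm_eq_abs]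
    exact abs_le_one_iff_mul_self_le_one.mpr (h1.trans h2.le)
  have hne : S.Nonempty := ⟨Pi.single ⟨0, ha⟩ 1, by simp [S]⟩
  obtain ⟨x, hx, hmin⟩ := hS.exists_isMinOn hne
    (f := fun x => x ⬝ᵥ M.mulVec x)
    (by unfold mulVec dotProduct; fun_prop)
  have hx0 : x ≠ 0 := by
    rintro rfl
    simp [S] at hx
  have hpos : 0 < x ⬝ᵥ M.mulVec x := by simpa using hM.dotProduct_mulVec_pos hx0
  refine hpos.trans_le (le_csInf ⟨_, x, hx, rfl⟩ ?_)
  rintro r ⟨y, hy, rfl⟩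
  exact hmin hy

theorem frobNormSq_nonneg (W : Matrix (Fin a) (Fin b) ℝ) : 0 ≤ frobNormSq W :=
  Finset.sum_nonneg fun _ _ => Finset.sum_nonneg fun _ _ => sq_nonneg _

theorem eigMin_mul_frobNormSq_le (hM : M.PosSemidef) (W : Matrix (Fin a) (Fin b) ℝ) :
    eigMin M * frobNormSq W ≤ (Wᵀ * M * W).trace := by
  have h1 : frobNormSq W = ∑ j, W.col j ⬝ᵥ W.col j := by
    rw [frobNormSq, Finset.sum_comm]
    simp [dotProduct, pow_two]
  have h2 : (Wᵀ * M * W).trace = ∑ j, W.col j ⬝ᵥ M.mulVec (W.col j) := by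
    refine Finset.sum_congr rfl fun j _ => ?_
    rw [Matrix.diag_apply, Matrix.mul_assoc]
    rfl
  rw [h1, h2, Finset.mul_sum]
  exact Finset.sum_le_sum fun j _ => eigMin_mul_dotProduct_le hM _

open scoped MatrixOrder Matrix.Norms.L2Operator in
theorem eigMin_mul_trace_le {S : Matrix (Fin a) (Fin a) ℝ} (hM : M.PosSemidef)
    (hS : S.PosSemidef) : eigMin M * S.trace ≤ (S * M).trace := by
  obtain ⟨B, rfl⟩ := CStarAlgebra.nonneg_iff_eq_star_mul_self.mp hS.nonneg
  have h := eigMin_mul_frobNormSq_le hM Bᵀ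
  have hB : frobNormSq Bᵀ = (Bᵀ * B).trace := by
    simp [frobNormSq, Matrix.trace, Matrix.mul_apply, pow_two]
  rw [hB, Matrix.transpose_transpose] at h
  rw [Matrix.star_eq_conjTranspose, Matrix.conjTranspose_eq_transpose_of_trivial,
    Matrix.trace_mul_cycle, Matrix.trace_mul_cycle]
  exact h

end Rayleigh

/-- Completion of squares for the maximizer's one-step problem. -/
theorem completion_of_squares {m n : ℕ} {P : Matrix (Fin m) (Fin m) ℝ}
    {C : Matrix (Fin m) (Fin m) ℝ} {D : Matrix (Fin m) (Fin n) ℝ}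
    {R H : Matrix (Fin n) (Fin n) ℝ} {L₀ : Matrix (Fin n) (Fin m) ℝ}
    (hP : Pᵀ = P) (hHt : Hᵀ = H) (hH : R = H + Dᵀ * P * D) (hL₀ : H * L₀ = -(Dᵀ * P * C))
    (L : Matrix (Fin n) (Fin m) ℝ) :
    Cᵀ * P * C + L₀ᵀ * H * L₀
      = (C - D * L)ᵀ * P * (C - D * L) - Lᵀ * R * L + (L₀ - L)ᵀ * H * (L₀ - L) := by
  have hL₀' : L₀ᵀ * H = -(Cᵀ * P * D) := by
    have := congrArg Matrix.transpose hL₀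
    simpa [Matrix.transpose_mul, hP, hHt, Matrix.mul_assoc] using this
  have e1 : L₀ᵀ * (H * L) = -(Cᵀ * (P * (D * L))) := by
    rw [← Matrix.mul_assoc, hL₀']
    simp [Matrix.mul_assoc]
  have e2 : Lᵀ * (H * L₀) = -(Lᵀ * (Dᵀ * (P * C))) := by
    rw [hL₀]
    simp [Matrix.mul_assoc]
  subst hH
  simp only [Matrix.transpose_sub, Matrix.transpose_mul, Matrix.sub_mul, Matrix.mul_sub,
    Matrix.add_mul, Matrix.mul_add, Matrix.mul_assoc, e1, e2]
  abel

namespace LQGame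

variable {m d n N : ℕ} (g : LQGame m d n N) (K : ℕ → Matrix (Fin d) (Fin m) ℝ)

theorem PKL_of_lt (L : ℕ → Matrix (Fin n) (Fin m) ℝ) {t : ℕ} (ht : t < N) :
    g.PKL K L t = (g.A t - g.B t * K t - g.D t * L t)ᵀ * g.PKL K L (t + 1) *
      (g.A t - g.B t * K t - g.D t * L t) + g.Q t + (K t)ᵀ * g.Ru t * K t
        - (L t)ᵀ * g.Rw t * L t := by
  obtain ⟨j, rfl⟩ : ∃ j, N = t + 1 + j := ⟨N - (t + 1), by omega⟩
  have h1 : t + 1 + j - t = j + 1 := by omega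
  have h2 : t + 1 + j - (t + 1) = j := by omega
  have h3 : t + 1 + j - (j + 1) = t := by omega
  simp only [PKL, h1, h2, PKLaux, h3]

theorem PK_of_lt {t : ℕ} (ht : t < N) :
    g.PK K t = g.Q t + (K t)ᵀ * g.Ru t * K t
      + (g.A t - g.B t * K t)ᵀ * g.Ptilde K t * (g.A t - g.B t * K t) := by
  obtain ⟨j, rfl⟩ : ∃ j, N = t + 1 + j := ⟨N - (t + 1), by omega⟩
  have h1 : t + 1 + j - t = j + 1 := by omega
  have h2 : t + 1 + j - (t + 1) = j := by omega
  have h3 : t + 1 + j - (j + 1) = t := by omega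
  simp only [PK, Ptilde, h1, h2, PKaux, h3]

variable {K}

theorem PK_transpose (hK : g.Admissible K) {t : ℕ} (ht : t ≤ N) :
    (g.PK K t)ᵀ = g.PK K t := by
  induction ht using Nat.decreasingInduction with
  | self => simpa [PK, PKaux] using g.hQN.isHermitian.eq
  | of_succ t ht ih =>
    have hQ : (g.Q t)ᵀ = g.Q t := by simpa using (g.hQ t ht).isHermitian.eq
    have hR : (g.Ru t)ᵀ = g.Ru t := by simpa using (g.hRu t ht).isHermitian.eq
    have hH : ((g.Rw t - (g.D t)ᵀ * g.PK K (t+1) * g.D t)⁻¹)ᵀ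
        = (g.Rw t - (g.D t)ᵀ * g.PK K (t+1) * g.D t)⁻¹ := by
      simpa using (hK t ht).isHermitian.inv.eq
    have hPt : (g.Ptilde K t)ᵀ = g.Ptilde K t := by
      rw [Ptilde]
      generalize (g.Rw t - (g.D t)ᵀ * g.PK K (t+1) * g.D t)⁻¹ = Y at hH ⊢
      simp only [Matrix.transpose_add, Matrix.transpose_mul, Matrix.transpose_transpose, hH, ih,
        Matrix.mul_assoc]
    rw [g.PK_of_lt K ht]
    simp only [Matrix.transpose_add, Matrix.transpose_mul, Matrix.transpose_transpose, hQ, hR, hPt,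
      Matrix.mul_assoc]

/-- One backward step of the gap between the inner Riccati matrix and the value matrix. -/
theorem PK_sub_PKL_of_lt (hK : g.Admissible K) (L : ℕ → Matrix (Fin n) (Fin m) ℝ) {t : ℕ}
    (ht : t < N) :
    g.PK K t - g.PKL K L t
      = (g.A t - g.B t * K t - g.D t * L t)ᵀ * (g.PK K (t + 1) - g.PKL K L (t + 1)) *
          (g.A t - g.B t * K t - g.D t * L t)
        + (g.Lopt K t - L t)ᵀ * (g.Rw t - (g.D t)ᵀ * g.PK K (t+1) * g.D t) *
          (g.Lopt K t - L t) := by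
  have hP := g.PK_transpose hK (Nat.succ_le_of_lt ht)
  have hHpd := hK t ht
  have hHt := hHpd.isHermitian.eq
  rw [Matrix.conjTranspose_eq_transpose_of_trivial] at hHt
  have hdet := (Matrix.isUnit_iff_isUnit_det _).mp hHpd.isUnit
  have hneg : -(g.Rw t) + (g.D t)ᵀ * g.PK K (t+1) * g.D t
      = -(g.Rw t - (g.D t)ᵀ * g.PK K (t+1) * g.D t) := by abel
  have hLopt : g.Lopt K t = -((g.Rw t - (g.D t)ᵀ * g.PK K (t+1) * g.D t)⁻¹ *
      ((g.D t)ᵀ * g.PK K (t+1) * (g.A t - g.B t * K t))) := by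
    rw [Lopt, hneg, ← Matrix.neg_mul]
    congr 1
    refine Matrix.inv_eq_left_inv ?_
    rw [neg_mul_neg, Matrix.nonsing_inv_mul _ hdet]
  have hL₀ : (g.Rw t - (g.D t)ᵀ * g.PK K (t+1) * g.D t) * g.Lopt K t
      = -((g.D t)ᵀ * g.PK K (t+1) * (g.A t - g.B t * K t)) := by
    rw [hLopt, Matrix.mul_neg, ← Matrix.mul_assoc, Matrix.mul_nonsing_inv _ hdet, Matrix.one_mul]
  have hsq := completion_of_squares hP hHt (R := g.Rw t) (by abel) hL₀ (L t)
  have hPt : (g.A t - g.B t * K t)ᵀ * g.Ptilde K t * (g.A t - g.B t * K t)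
      = (g.A t - g.B t * K t)ᵀ * g.PK K (t+1) * (g.A t - g.B t * K t)
        + (g.Lopt K t)ᵀ * (g.Rw t - (g.D t)ᵀ * g.PK K (t+1) * g.D t) * g.Lopt K t := by
    rw [Matrix.mul_assoc (g.Lopt K t)ᵀ, hL₀, hLopt, Ptilde, Matrix.transpose_neg,
      Matrix.neg_mul, Matrix.mul_neg, neg_neg, Matrix.transpose_mul, Matrix.transpose_nonsing_inv, hHt]
    simp only [Matrix.mul_add, Matrix.add_mul, Matrix.transpose_mul, Matrix.transpose_transpose,
      hP, Matrix.mul_assoc]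
  rw [g.PK_of_lt K ht, g.PKL_of_lt K L ht, hPt, hsq,
    Matrix.mul_sub _ (g.PK K (t + 1)), Matrix.sub_mul (_ * g.PK K (t + 1))]
  abel

theorem posSemidef_PK_sub_PKL (hK : g.Admissible K) (L : ℕ → Matrix (Fin n) (Fin m) ℝ) {t : ℕ}
    (ht : t ≤ N) : (g.PK K t - g.PKL K L t).PosSemidef := by
  induction ht using Nat.decreasingInduction with
  | self => simpa [PK, PKL, PKaux, PKLaux] using Matrix.PosSemidef.zero
  | of_succ t ht ih =>
    rw [g.PK_sub_PKL_of_lt hK L ht]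
    exact (ih.conjTranspose_mul_mul_same _).add ((hK t ht).posSemidef.conjTranspose_mul_mul_same _)

theorem PKL_Lopt (hK : g.Admissible K) {t : ℕ} (ht : t ≤ N) :
    g.PKL K (g.Lopt K) t = g.PK K t := by
  induction ht using Nat.decreasingInduction with
  | self => simp [PK, PKL, PKaux, PKLaux]
  | of_succ t ht ih =>
    have h := g.PK_sub_PKL_of_lt hK (g.Lopt K) ht
    rw [ih, sub_self, sub_self, Matrix.mul_zero, Matrix.zero_mul, Matrix.mul_zero, add_zero] at h
    exact (sub_eq_zero.mp h).symm

/-- The stagewise gap matrix dominates its one-step quadratic part in trace. -/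
theorem eigMin_mul_frobNormSq_le_trace (hK : g.Admissible K)
    (L : ℕ → Matrix (Fin n) (Fin m) ℝ) {t : ℕ} (ht : t < N) :
    eigMin (g.Rw t - (g.D t)ᵀ * g.PK K (t+1) * g.D t) * frobNormSq (g.Lopt K t - L t)
      ≤ (g.PK K t - g.PKL K L t).trace := by
  rw [g.PK_sub_PKL_of_lt hK L ht, Matrix.trace_add]
  have h := ((g.posSemidef_PK_sub_PKL hK L (Nat.succ_le_of_lt ht)).conjTranspose_mul_mul_same
    (g.A t - g.B t * K t - g.D t * L t)).trace_nonneg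
  rw [Matrix.conjTranspose_eq_transpose_of_trivial] at h
  exact (eigMin_mul_frobNormSq_le (hK t ht).posSemidef _).trans (le_add_of_nonneg_left h)

theorem value_Lopt_sub_value (hK : g.Admissible K) (L : ℕ → Matrix (Fin n) (Fin m) ℝ) :
    g.value K (g.Lopt K) - g.value K L
      = ∑ t ∈ Finset.range (N+1), ((g.PK K t - g.PKL K L t) * g.Sig t).trace := by
  rw [value, value, ← Finset.sum_sub_distrib]
  refine Finset.sum_congr rfl fun t ht => ?_
  rw [g.PKL_Lopt hK (Nat.lt_succ_iff.mp (Finset.mem_range.mp ht)), Matrix.sub_mul,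
    Matrix.trace_sub]

theorem phi_nonneg : 0 ≤ g.phi :=
  Finset.le_inf' _ _ fun t ht =>
    eigMin_nonneg (g.hSig t (Nat.lt_succ_iff.mp (Finset.mem_range.mp ht))).posSemidef

theorem phi_pos (hm : 0 < m) : 0 < g.phi :=
  (Finset.lt_inf'_iff _).mpr fun t ht =>
    eigMin_pos hm (g.hSig t (Nat.lt_succ_iff.mp (Finset.mem_range.mp ht)))

theorem phi_mul_trace_le (hK : g.Admissible K) (L : ℕ → Matrix (Fin n) (Fin m) ℝ) {t : ℕ}
    (ht : t ≤ N) :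
    g.phi * (g.PK K t - g.PKL K L t).trace ≤ ((g.PK K t - g.PKL K L t) * g.Sig t).trace := by
  have hps := g.posSemidef_PK_sub_PKL hK L ht
  refine le_trans (mul_le_mul_of_nonneg_right ?_ hps.trace_nonneg)
    (eigMin_mul_trace_le (g.hSig t ht).posSemidef hps)
  exact Finset.inf'_le _ (Finset.mem_range.mpr (Nat.lt_succ_of_le ht))

end LQGame

/-- quadratic growth of the inner-loop optimality gap in the gain. -/
theorem LQGame.inner_quadratic_growth {m d n N : ℕ} (g : LQGame m d n N)
    (hN : 0 < N) (K : ℕ → Matrix (Fin d) (Fin m) ℝ) (hK : g.Admissible K) :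
    ∀ L : ℕ → Matrix (Fin n) (Fin m) ℝ,
      (g.phi * (Finset.range N).inf' (Finset.nonempty_range_iff.mpr hN.ne')
            (fun t => eigMin (g.Rw t - (g.D t)ᵀ * g.PK K (t+1) * g.D t)) *
          ∑ t ∈ Finset.range N, frobNormSq (g.Lopt K t - L t))
        ≤ g.value K (g.Lopt K) - g.value K L
      ∧ Real.sqrt (∑ t ∈ Finset.range N, frobNormSq (g.Lopt K t - L t))
        ≤ Real.sqrt ((g.value K (g.Lopt K) - g.value K L)
            / (g.phi * (Finset.range N).inf' (Finset.nonempty_range_iff.mpr hN.ne')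
                (fun t => eigMin (g.Rw t - (g.D t)ᵀ * g.PK K (t+1) * g.D t)))) := by
  intro L
  set lam := (Finset.range N).inf' (Finset.nonempty_range_iff.mpr hN.ne')
    (fun t => eigMin (g.Rw t - (g.D t)ᵀ * g.PK K (t+1) * g.D t))
  have hgrowth : g.phi * lam * ∑ t ∈ Finset.range N, frobNormSq (g.Lopt K t - L t)
      ≤ g.value K (g.Lopt K) - g.value K L := by
    rw [g.value_Lopt_sub_value hK L, Finset.sum_range_succ, Finset.mul_sum]
    have hlast := (mul_nonneg g.phi_nonneg (g.posSemidef_PK_sub_PKL hK L le_rfl).trace_nonneg).trans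
      (g.phi_mul_trace_le hK L le_rfl)
    refine (Finset.sum_le_sum fun t ht => ?_).trans (le_add_of_nonneg_right hlast)
    have htN := Finset.mem_range.mp ht
    refine le_trans ?_ (g.phi_mul_trace_le hK L htN.le)
    rw [mul_assoc]
    refine mul_le_mul_of_nonneg_left ?_ g.phi_nonneg
    exact (mul_le_mul_of_nonneg_right (Finset.inf'_le _ ht) (frobNormSq_nonneg _)).trans
      (g.eigMin_mul_frobNormSq_le_trace hK L htN)
  refine ⟨hgrowth, ?_⟩
  rcases Nat.eq_zero_or_pos m with rfl | hm
  · simp [frobNormSq]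
  rcases Nat.eq_zero_or_pos n with rfl | hn
  · simp [frobNormSq]
  have hlam_pos : 0 < lam := (Finset.lt_inf'_iff _).mpr fun t ht =>
    eigMin_pos hn (hK t (Finset.mem_range.mp ht))
  refine Real.sqrt_le_sqrt ?_
  rw [le_div_iff₀ (mul_pos (g.phi_pos hm) hlam_pos), mul_comm]
  exact hgrowth
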